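/- Let K = ℚ(θ^{1/n}) with x^n − θ irreducible, n > 3k, and define the lattices Λ_v = {x ∈ ℤ^n : x · T^i(rev(v)) = 0 for 0 ≤ i ≤ k−1} for v ∈ ℤ^n \ {0}, where T is the shift-with-θ map and rev reverses coordinates. Then Λ_v has rank n−k, and Λ_v admits a ℤ-basis z_1,...,z_{n−k} with ‖z_i‖ ≍ Z_i (the successive minima), ‖Σλ_i z_i‖ ≫ Σ ‖λ_i z_i‖ for all real λ_i, and such that the 2k vectors T^0(z_1),...,T^{k−1}(z_1),T^0(z_{k+1}),...,T^{k−1}(z_{k+1}) are linearly independent. -/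

import Mathlib

/-- The shift-with-`θ` map on `ℝ^n`. -/
noncomputable def Tmap (n : ℕ) (θ : ℤ) (v : Fin n → ℝ) : Fin n → ℝ :=
  fun j => if h : (j : ℕ) + 1 < n then v ⟨(j : ℕ) + 1, h⟩ else (θ : ℝ) * v ⟨0, j.pos⟩

/-- The shift-with-`θ` map on `ℤ^n`. -/
def TmapZ (n : ℕ) (θ : ℤ) (v : Fin n → ℤ) : Fin n → ℤ :=
  fun j => if h : (j : ℕ) + 1 < n then v ⟨(j : ℕ) + 1, h⟩ else θ * v ⟨0, j.pos⟩

/-- Coordinate reversal. -/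
def revZ (n : ℕ) (v : Fin n → ℤ) : Fin n → ℤ := fun j => v j.rev

/-- The lattice `Λ_v = {x ∈ ℤ^n : x · Tⁱ(rev v) = 0, 0 ≤ i ≤ k-1}`. -/
def LamV (n k : ℕ) (θ : ℤ) (v : Fin n → ℤ) : Set (Fin n → ℤ) :=
  {x | ∀ i < k, ∑ t, x t * ((TmapZ n θ)^[i] (revZ n v)) t = 0}

/-- Euclidean norm of an integer vector. -/
noncomputable def nrmZ {n : ℕ} (x : Fin n → ℤ) : ℝ := Real.sqrt (∑ i, ((x i : ℝ)) ^ 2)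

/-- Euclidean norm of a real vector. -/
noncomputable def nrmR {n : ℕ} (x : Fin n → ℝ) : ℝ := Real.sqrt (∑ i, (x i) ^ 2)

open Polynomial in
/-- If every nonzero polynomial of small degree in `T` acts injectively, then among the linear
combinations of `k + 1` independent vectors there is one which has, together with `x`, no
relation of degree less than `k`. -/
theorem exists_combination_without_relation {V : Type*} [AddCommGroup V] [Module ℚ V]
    (T : V →ₗ[ℚ] V) (n k : ℕ) (hk : 1 ≤ k) (hnk : 3 * k < n)
    (H : ∀ p : ℚ[X], p ≠ 0 → p.natDegree < n → ∀ x : V, x ≠ 0 → aeval T p x ≠ 0)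
    (x : V) (hx : x ≠ 0) (y : Fin (k + 1) → V) (hy : LinearIndependent ℚ y) :
    ∃ c : Fin (k + 1) → ℚ, ∀ p q : ℚ[X], p.natDegree < k → q.natDegree < k →
      aeval T p x + aeval T q (∑ i, c i • y i) = 0 → p = 0 ∧ q = 0 := by
  by_contra! hcon
  choose p q hp hq hrel hne using hcon
  have hq0 : ∀ c, q c ≠ 0 := by
    intro c hqc
    have hp0 : p c ≠ 0 := fun h => hne c h hqc
    have := hrel c
    rw [hqc] at this
    simp only [map_zero, LinearMap.zero_apply, add_zero] at this
    exact H _ hp0 ((hp c).trans (by omega)) x hx this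
  have haddsmul : ∀ (a : ℚ) (c d : Fin (k + 1) → ℚ),
      p (a • c + d) * (q c * q d) = q (a • c + d) * (C a * p c * q d + p d * q c) := by
    intro a c d
    by_contra hcon
    set r := p (a • c + d) * (q c * q d) - q (a • c + d) * (C a * p c * q d + p d * q c) with hr
    have hr0 : r ≠ 0 := sub_ne_zero.mpr hcon
    have h1 := hp (a • c + d)
    have h2 := hp c
    have h3 := hp d
    have h4 := hq (a • c + d)
    have h5 := hq c
    have h6 := hq d
    have hdeg : r.natDegree < n := by
      have e1 : (p (a • c + d) * (q c * q d)).natDegree ≤ 3 * (k - 1) :=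
        natDegree_mul_le.trans (by have := natDegree_mul_le (p := q c) (q := q d); omega)
      have e2 : (C a * p c * q d + p d * q c).natDegree ≤ 2 * (k - 1) := by
        refine (natDegree_add_le _ _).trans (max_le ?_ ?_)
        · have := natDegree_mul_le (p := C a * p c) (q := q d)
          have := natDegree_C_mul_le a (p c)
          omega
        · have := natDegree_mul_le (p := p d) (q := q c)
          omega
      have e3 := natDegree_mul_le (p := q (a • c + d)) (q := C a * p c * q d + p d * q c)
      have := natDegree_sub_le (p (a • c + d) * (q c * q d))
        (q (a • c + d) * (C a * p c * q d + p d * q c))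
      rw [← hr] at this
      omega
    refine H r hr0 hdeg x hx ?_
    have hs : ∑ i, (a • c + d) i • y i = a • (∑ i, c i • y i) + ∑ i, d i • y i := by
      simp only [Pi.add_apply, Pi.smul_apply, add_smul, Finset.sum_add_distrib, Finset.smul_sum,
        smul_eq_mul, mul_smul]
    have g1 := hrel (a • c + d)
    rw [hs] at g1
    have g2 := hrel c
    have g3 := hrel d
    generalize (∑ i, c i • y i) = u at g1 g2
    generalize (∑ i, d i • y i) = w at g1 g3
    have g1' := congrArg (aeval T (q c * q d)) g1
    have g2' := congrArg (aeval T (C a * (q (a • c + d) * q d))) g2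
    have g3' := congrArg (aeval T (q (a • c + d) * q c)) g3
    simp only [map_add, map_smul, ← Module.End.mul_apply, ← map_mul, map_zero] at g1' g2' g3'
    have hsub : aeval T r x = aeval T (q c * q d * p (a • c + d)) x
        - aeval T (C a * (q (a • c + d) * q d) * p c) x
        - aeval T (q (a • c + d) * q c * p d) x := by
      rw [← LinearMap.sub_apply, ← LinearMap.sub_apply, ← map_sub, ← map_sub, hr]
      congr 2
      ring
    rw [hsub]
    have k2 : aeval T (C a * (q (a • c + d) * q d) * q c) u
        = a • aeval T (q c * q d * q (a • c + d)) u := by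
      rw [show C a * (q (a • c + d) * q d) * q c = C a * (q c * q d * q (a • c + d)) by ring]
      simp [Module.algebraMap_end_apply]
    have k3 : aeval T (q (a • c + d) * q c * q d) w = aeval T (q c * q d * q (a • c + d)) w := by
      congr 2; ring
    rw [k2] at g2'
    rw [k3] at g3'
    linear_combination (norm := module) g1' - g2' - g3'
  let i : ℚ[X] →+* FractionRing ℚ[X] := algebraMap ℚ[X] (FractionRing ℚ[X])
  have hi : Function.Injective i := IsFractionRing.injective ℚ[X] (FractionRing ℚ[X])
  have hiq : ∀ c, i (q c) ≠ 0 := fun c => by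
    rw [Ne, map_eq_zero_iff i hi]; exact hq0 c
  let φ : (Fin (k + 1) → ℚ) → FractionRing ℚ[X] := fun c => i (p c) / i (q c)
  have hφ : ∀ (a : ℚ) c d, φ (a • c + d) = i (C a) * φ c + φ d := by
    intro a c d
    have := congrArg i (haddsmul a c d)
    simp only [map_mul, map_add] at this
    have h1 := hiq c
    have h2 := hiq d
    have h3 := hiq (a • c + d)
    simp only [φ]
    field_simp
    linear_combination this
  have hφ0 : φ 0 = 0 := by simpa using hφ 1 0 0
  let e : Fin (k + 1) → (Fin (k + 1) → ℚ) := fun j => Pi.single j 1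
  have hφsum : ∀ (c : Fin (k + 1) → ℚ) (s : Finset (Fin (k + 1))),
      φ (∑ j ∈ s, c j • e j) = ∑ j ∈ s, i (C (c j)) * φ (e j) := by
    intro c s
    induction s using Finset.induction_on with
    | empty => simpa using hφ0
    | insert j s hj ih => rw [Finset.sum_insert hj, Finset.sum_insert hj, hφ, ih]
  have hφc : ∀ c, φ c = ∑ j, i (C (c j)) * φ (e j) := by
    intro c
    rw [← hφsum c Finset.univ]
    congr 1
    exact pi_eq_sum_univ' c
  let D : ℚ[X] := ∏ j, q (e j)
  have hD : D ≠ 0 := Finset.prod_ne_zero_iff.mpr fun j _ => hq0 _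
  let P : (Fin (k + 1) → ℚ) → ℚ[X] := fun c =>
    ∑ j, C (c j) * (p (e j) * ∏ l ∈ Finset.univ.erase j, q (e l))
  have hP : ∀ c, q c * P c = D * p c := by
    intro c
    apply hi
    have h1 : i (P c) = i D * φ c := by
      rw [hφc, Finset.mul_sum, map_sum]
      refine Finset.sum_congr rfl fun j _ => ?_
      have : D = q (e j) * ∏ l ∈ Finset.univ.erase j, q (e l) :=
        (Finset.mul_prod_erase _ _ (Finset.mem_univ j)).symm
      rw [this]
      simp only [map_mul, φ]
      have := hiq (e j)
      field_simp
    rw [map_mul, map_mul, h1]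
    simp only [φ]
    have := hiq c
    field_simp
  obtain ⟨A, hA, hAk⟩ : ∃ A : Finset ℚ, (A : Set ℚ) ⊆ {a | D.eval a ≠ 0} ∧ A.card = k := by
    refine Set.Infinite.exists_subset_card_eq ?_ k
    have : {a : ℚ | D.eval a ≠ 0} = ((D.roots.toFinset : Finset ℚ) : Set ℚ)ᶜ := by
      ext a; simp [hD]
    rw [this]
    exact (Finset.finite_toSet _).infinite_compl
  let ev : (Fin (k + 1) → ℚ) →ₗ[ℚ] (A → ℚ) :=
    { toFun := fun c a => (P c).eval (a : ℚ)
      map_add' := fun c d => by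
        ext a
        simp [P, add_mul, Finset.sum_add_distrib, eval_finsetSum]
      map_smul' := fun r c => by
        ext a
        simp [P, mul_assoc, Finset.mul_sum, eval_finsetSum] }
  have hker : LinearMap.ker ev ≠ ⊥ := LinearMap.ker_ne_bot_of_finrank_lt (by simp [hAk])
  obtain ⟨c, hc, hc0⟩ := (Submodule.ne_bot_iff _).mp hker
  have hpc : p c = 0 := by
    refine eq_zero_of_natDegree_lt_card_of_eval_eq_zero' _ A (fun a ha => ?_) (by rw [hAk]; exact hp c)
    have h1 : (P c).eval a = 0 := congrFun (LinearMap.mem_ker.mp hc) ⟨a, ha⟩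
    have h2 := congrArg (eval a) (hP c)
    rw [eval_mul, eval_mul, h1, mul_zero] at h2
    exact (mul_eq_zero.mp h2.symm).resolve_left (hA ha)
  have hyc : ∑ j, c j • y j ≠ 0 := fun h =>
    hc0 (funext (Fintype.linearIndependent_iff.mp hy c h))
  have := hrel c
  rw [hpc] at this
  simp only [map_zero, LinearMap.zero_apply, zero_add] at this
  exact H _ (hq0 c) ((hq c).trans (by omega)) _ hyc this

/-- The vectors `Tⁱ x` and `Tⁱ y` for `i < k`. -/
def orbitPair {R V : Type*} [Semiring R] [AddCommMonoid V] [Module R V] (T : V →ₗ[R] V) (k : ℕ)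
    (x y : V) : Fin k ⊕ Fin k → V :=
  Sum.elim (fun i => (T ^ (i : ℕ)) x) (fun i => (T ^ (i : ℕ)) y)

open Polynomial in
theorem linearIndependent_orbitPair {V : Type*} [AddCommGroup V] [Module ℚ V] (T : V →ₗ[ℚ] V)
    (k : ℕ) (hk : 1 ≤ k) (x y : V)
    (h : ∀ p q : ℚ[X], p.natDegree < k → q.natDegree < k →
      aeval T p x + aeval T q y = 0 → p = 0 ∧ q = 0) :
    LinearIndependent ℚ (orbitPair T k x y) := by
  have hdeg : ∀ g : Fin k → ℚ, (∑ i, C (g i) * X ^ (i : ℕ)).natDegree < k := fun g => by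
    refine lt_of_le_of_lt (natDegree_sum_le_of_forall_le (n := k - 1) _ _ fun i _ => ?_) (by omega)
    exact (natDegree_C_mul_X_pow_le _ _).trans (by omega)
  have hev : ∀ (g : Fin k → ℚ) (z : V),
      aeval T (∑ i, C (g i) * X ^ (i : ℕ)) z = ∑ i, g i • (T ^ (i : ℕ)) z := fun g z => by
    simp [LinearMap.sum_apply, Module.algebraMap_end_apply]
  have hcoef : ∀ (g : Fin k → ℚ) (j : Fin k),
      (∑ i, C (g i) * X ^ (i : ℕ)).coeff (j : ℕ) = g j := fun g j => by
    simp [coeff_C_mul, coeff_X_pow, Fin.val_inj]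
  rw [Fintype.linearIndependent_iff]
  intro g hg
  rw [Fintype.sum_sum_type] at hg
  simp only [orbitPair, Sum.elim_inl, Sum.elim_inr] at hg
  obtain ⟨h1, h2⟩ := h _ _ (hdeg fun i => g (.inl i)) (hdeg fun i => g (.inr i))
    (by rw [hev, hev]; exact hg)
  rintro (j | j)
  · rw [← hcoef (fun i => g (.inl i)) j, h1, coeff_zero]
  · rw [← hcoef (fun i => g (.inr i)) j, h2, coeff_zero]

open Polynomial in
theorem exists_linearIndependent_add_smul {K V ι : Type*} [Field K] [AddCommGroup V] [Module K V]
    [Fintype ι] (u w : ι → V) (t₀ : K)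
    (h : LinearIndependent K (fun i => u i + t₀ • w i)) (S : Finset K)
    (hS : Fintype.card ι < S.card) :
    ∃ t ∈ S, LinearIndependent K (fun i => u i + t • w i) := by
  classical
  obtain ⟨g, hg⟩ := LinearMap.exists_leftInverse_of_injective
    (Fintype.linearCombination K (fun i => u i + t₀ • w i))
    (by rw [LinearMap.ker_eq_bot']; exact fun m hm => funext (Fintype.linearIndependent_iff.mp h m hm))
  let A : Matrix ι ι K := Matrix.of fun i => g (w i)
  let B : Matrix ι ι K := Matrix.of fun i => g (u i)
  let P : K[X] := Matrix.det ((X : K[X]) • A.map C + B.map C)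
  have hev : ∀ t, P.eval t = Matrix.det (Matrix.of fun i => g (u i + t • w i)) := by
    intro t
    rw [← coe_evalRingHom, RingHom.map_det]
    congr 1
    ext i j
    simp [A, B, add_comm]
    ring
  have h0 : P.eval t₀ ≠ 0 := by
    rw [hev]
    have : Matrix.of (fun i => g (u i + t₀ • w i)) = (1 : Matrix ι ι K) := by
      ext i j
      have := congrArg (fun f => f (Pi.single i 1) j) hg
      simp only [LinearMap.comp_apply, LinearMap.id_apply, Fintype.linearCombination_apply_single,
        one_smul] at this
      rw [Matrix.of_apply, this, Matrix.one_eq_pi_single]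
    rw [this, Matrix.det_one]
    exact one_ne_zero
  by_contra! hcon
  have hP : P = 0 := by
    refine eq_zero_of_natDegree_lt_card_of_eval_eq_zero' P S (fun t ht => ?_)
      ((natDegree_det_X_add_C_le A B).trans_lt hS)
    by_contra hne
    rw [hev] at hne
    exact hcon t ht (LinearIndependent.of_comp g (Matrix.linearIndependent_rows_of_det_ne_zero hne))
  exact h0 (by rw [hP, eval_zero])

theorem exists_linearIndependent_orbitPair_add_smul {V : Type*} [AddCommGroup V] [Module ℚ V]
    (T : V →ₗ[ℚ] V) (k : ℕ) (x y w : V) (h : LinearIndependent ℚ (orbitPair T k x y))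
    (S : Finset ℚ) (hS : 2 * k < S.card) :
    ∃ t ∈ S, LinearIndependent ℚ (orbitPair T k x (y + t • w)) := by
  have key : ∀ t : ℚ, orbitPair T k x (y + t • w)
      = fun i => orbitPair T k x y i + t • orbitPair T k 0 w i := by
    intro t
    ext (i | i) <;> simp [orbitPair]
  obtain ⟨t, ht, hLI⟩ := exists_linearIndependent_add_smul (orbitPair T k x y) (orbitPair T k 0 w)
    (0 : ℚ) (by simpa using h) S (by simpa [two_mul] using hS)
  exact ⟨t, ht, by rwa [key]⟩

open Polynomial in
theorem exists_bounded_combination {V : Type*} [AddCommGroup V] [Module ℚ V] (T : V →ₗ[ℚ] V)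
    (n k : ℕ) (hk : 1 ≤ k) (hnk : 3 * k < n)
    (H : ∀ p : ℚ[X], p ≠ 0 → p.natDegree < n → ∀ x : V, x ≠ 0 → aeval T p x ≠ 0)
    (x : V) (hx : x ≠ 0) (y : Fin (k + 1) → V) (hy : LinearIndependent ℚ y) :
    ∃ c : Fin k → ℕ, (∀ i, c i ≤ 2 * k) ∧ LinearIndependent ℚ
      (orbitPair T k x (y (Fin.last k) + ∑ i, (c i : ℚ) • y i.castSucc)) := by
  obtain ⟨a, ha⟩ := exists_combination_without_relation T n k hk hnk H x hx y hy
  have h1 := linearIndependent_orbitPair T k hk x _ ha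
  rw [Fin.sum_univ_castSucc] at h1
  obtain ⟨S, hSsub, hScard⟩ : ∃ S : Finset ℚ,
      (S : Set ℚ) ⊆ {-a (Fin.last k)}ᶜ ∧ S.card = 2 * k + 1 :=
    (Set.finite_singleton _).infinite_compl.exists_subset_card_eq _
  obtain ⟨t, ht, h2⟩ := exists_linearIndependent_orbitPair_add_smul T k x _ (y (Fin.last k)) h1 S
    (by omega)
  have hs : a (Fin.last k) + t ≠ 0 := fun h => hSsub ht (by
    rw [Set.mem_singleton_iff]; linarith)
  set s := a (Fin.last k) + t
  have h3 : LinearIndependent ℚ (orbitPair T k x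
      (y (Fin.last k) + ∑ i : Fin k, (s⁻¹ * a i.castSucc) • y i.castSucc)) := by
    have := h2.units_smul (Sum.elim (fun _ => 1) (fun _ => (Units.mk0 s hs)⁻¹))
    convert this using 1
    ext (i | i)
    · simp [orbitPair]
    · simp only [orbitPair, Sum.elim_inr, Pi.smul_apply', Units.smul_def, Units.val_inv_eq_inv_val,
        Units.val_mk0]
      rw [← map_smul]
      congr 1
      simp only [smul_add, Finset.smul_sum, mul_smul]
      rw [add_assoc, ← smul_add, ← add_smul, inv_smul_smul₀ hs, add_comm]
  have h4 : ∀ I : Finset (Fin k), ∃ c : Fin k → ℚ, (∀ i ∈ I, ∃ m : ℕ, m ≤ 2 * k ∧ c i = m) ∧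
      LinearIndependent ℚ (orbitPair T k x (y (Fin.last k) + ∑ i, c i • y i.castSucc)) := by
    intro I
    induction I using Finset.induction_on with
    | empty => exact ⟨_, by simp, h3⟩
    | insert j I hj ih =>
      obtain ⟨c, hc, hLI⟩ := ih
      obtain ⟨t, ht, hLI'⟩ := exists_linearIndependent_orbitPair_add_smul T k x _ (y j.castSucc)
        hLI ((Finset.range (2 * k + 1)).image fun m : ℕ => (m : ℚ) - c j) (by
          rw [Finset.card_image_of_injective _ fun a b h => by simpa using h]
          simp)
      obtain ⟨m, hm, rfl⟩ := Finset.mem_image.mp ht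
      refine ⟨c + Pi.single j ((m : ℚ) - c j), fun i hi => ?_, ?_⟩
      · rcases eq_or_ne i j with rfl | hij
        · exact ⟨m, by simpa [Nat.lt_succ_iff] using hm, by simp⟩
        · obtain ⟨m', hm', he⟩ := hc i (Finset.mem_of_mem_insert_of_ne hi hij)
          exact ⟨m', hm', by simp [hij, he]⟩
      · convert hLI' using 2
        simp [add_smul, Finset.sum_add_distrib, add_assoc, Pi.single_apply, ite_smul]
  obtain ⟨c, hc, hLI⟩ := h4 Finset.univ
  choose m hm hcm using fun i => hc i (Finset.mem_univ i)
  exact ⟨m, hm, by simpa only [hcm] using hLI⟩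

/-- The shift-with-`θ` map over a commutative ring, as a linear map. -/
def shiftLin (R : Type*) [CommRing R] (n : ℕ) (θ : R) : (Fin n → R) →ₗ[R] (Fin n → R) where
  toFun v j := if h : (j : ℕ) + 1 < n then v ⟨(j : ℕ) + 1, h⟩ else θ * v ⟨0, j.pos⟩
  map_add' v w := by
    ext j
    by_cases h : (j : ℕ) + 1 < n <;> simp [h, mul_add]
  map_smul' c v := by
    ext j
    by_cases h : (j : ℕ) + 1 < n <;> simp [h, mul_left_comm]

theorem shiftLin_pow_apply {R : Type*} [CommRing R] (n : ℕ) (θ : R) (v : Fin n → R) (i : ℕ)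
    (hi : i ≤ n) (j : Fin n) :
    (shiftLin R n θ ^ i) v j = if h : (j : ℕ) + i < n then v ⟨j + i, h⟩
      else θ * v ⟨j + i - n, by omega⟩ := by
  induction i generalizing j with
  | zero => simp
  | succ i ih =>
    rw [pow_succ', Module.End.mul_apply]
    change (if h : (j : ℕ) + 1 < n then ((shiftLin R n θ ^ i) v) ⟨(j : ℕ) + 1, h⟩
      else θ * ((shiftLin R n θ ^ i) v) ⟨0, j.pos⟩) = _
    split_ifs with h1 h2 h2
    · rw [ih (by omega), dif_pos (by simp only; omega)]
      congr 2; simp only; omega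
    · rw [ih (by omega), dif_neg (by simp only; omega)]
      congr 3; simp only; omega
    · omega
    · rw [ih (by omega), dif_pos (by simp only; omega)]
      congr 3; simp only; omega

theorem shiftLin_pow_map {R S : Type*} [CommRing R] [CommRing S] (f : R →+* S) (n : ℕ) (θ : R)
    (v : Fin n → R) (i : ℕ) (j : Fin n) :
    f ((shiftLin R n θ ^ i) v j) = (shiftLin S n (f θ) ^ i) (f ∘ v) j := by
  induction i generalizing j with
  | zero => simp
  | succ i ih =>
    rw [pow_succ', pow_succ', Module.End.mul_apply, Module.End.mul_apply]
    simp only [shiftLin, LinearMap.coe_mk, AddHom.coe_mk]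
    split_ifs with h
    · exact ih _
    · rw [map_mul]; congr 1; exact ih _

theorem Tmap_iterate (n : ℕ) (θ : ℤ) (i : ℕ) (v : Fin n → ℝ) :
    (Tmap n θ)^[i] v = (shiftLin ℝ n (θ : ℝ) ^ i) v := by
  rw [Module.End.pow_apply]; rfl

theorem TmapZ_iterate (n : ℕ) (θ : ℤ) (i : ℕ) (v : Fin n → ℤ) :
    (TmapZ n θ)^[i] v = (shiftLin ℤ n θ ^ i) v := by
  rw [Module.End.pow_apply]; rfl

open Polynomial in
theorem aeval_shiftLin_ne_zero (n : ℕ) (θ : ℚ)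
    (hirr : Irreducible ((X : ℚ[X]) ^ n - C θ)) (p : ℚ[X]) (hp : p ≠ 0) (hpn : p.natDegree < n)
    (x : Fin n → ℚ) (hx : x ≠ 0) : aeval (shiftLin ℚ n θ) p x ≠ 0 := by
  intro h0
  have hT : aeval (shiftLin ℚ n θ) ((X : ℚ[X]) ^ n - C θ) = 0 := by
    ext v j
    simp [Module.algebraMap_end_apply, shiftLin_pow_apply]
  have hcop : IsCoprime ((X : ℚ[X]) ^ n - C θ) p := by
    refine (hirr.coprime_iff_not_dvd).mpr fun hdvd => ?_
    have := natDegree_le_of_dvd hdvd hp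
    rw [natDegree_X_pow_sub_C] at this
    omega
  obtain ⟨a, b, hab⟩ := hcop
  apply hx
  have := congrArg (fun q => aeval (shiftLin ℚ n θ) q x) hab
  simpa [hT, h0] using this.symm

open Polynomial in
theorem linearIndependent_orbit {V : Type*} [AddCommGroup V] [Module ℚ V] (T : V →ₗ[ℚ] V)
    (n k : ℕ) (hk : 1 ≤ k) (hkn : k ≤ n)
    (H : ∀ p : ℚ[X], p ≠ 0 → p.natDegree < n → ∀ x : V, x ≠ 0 → aeval T p x ≠ 0)
    (x : V) (hx : x ≠ 0) : LinearIndependent ℚ (fun i : Fin k => (T ^ (i : ℕ)) x) := by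
  rw [Fintype.linearIndependent_iff]
  intro g hg j
  set p : ℚ[X] := ∑ i : Fin k, C (g i) * X ^ (i : ℕ) with hp
  have hdeg : p.natDegree < k := by
    refine lt_of_le_of_lt (natDegree_sum_le_of_forall_le (n := k - 1) _ _ fun i _ => ?_) (by omega)
    exact (natDegree_C_mul_X_pow_le _ _).trans (by omega)
  have hev : aeval T p x = 0 := by
    rw [← hg]
    simp [hp, LinearMap.sum_apply, Module.algebraMap_end_apply]
  have hp0 : p = 0 := by
    by_contra h
    exact H p h (hdeg.trans_le hkn) x hx hev
  have hcoef : p.coeff (j : ℕ) = g j := by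
    simp [hp, coeff_C_mul, coeff_X_pow, Fin.val_inj]
  rw [← hcoef, hp0, coeff_zero]

open Matrix in
theorem finrank_ker_of_linearIndependent_rows {n k : ℕ} (a : Fin k → Fin n → ℤ)
    (ha : LinearIndependent ℤ a) :
    Module.finrank ℤ (LinearMap.ker (Matrix.mulVecLin (Matrix.of a))) = n - k := by
  set f := Matrix.mulVecLin (Matrix.of a) with hf
  have h1 := Submodule.finrank_quotient_add_finrank (LinearMap.ker f)
  rw [f.quotKerEquivRange.finrank_eq, Module.finrank_fin_fun] at h1
  have hinj : Function.Injective (f ∘ₗ Matrix.mulVecLin (Matrix.of a).transpose) := by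
    rw [← LinearMap.ker_eq_bot, LinearMap.ker_eq_bot']
    intro y hy
    rw [LinearMap.comp_apply, hf, Matrix.mulVecLin_apply, Matrix.mulVecLin_apply] at hy
    have h2 := congrArg (fun z => y ⬝ᵥ z) hy
    simp only [dotProduct_zero] at h2
    rw [Matrix.dotProduct_mulVec, ← Matrix.mulVec_transpose, dotProduct_self_eq_zero] at h2
    refine funext (Fintype.linearIndependent_iff.mp ha y ?_)
    rw [← h2]
    ext t
    simp [Matrix.mulVec, dotProduct, mul_comm]
  have h2 : k ≤ Module.finrank ℤ (LinearMap.range f) := by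
    have := Submodule.finrank_mono (LinearMap.range_comp_le_range (Matrix.of a)ᵀ.mulVecLin f)
    rwa [LinearMap.finrank_range_of_inj hinj, Module.finrank_fin_fun] at this
  have h3 : Module.finrank ℤ (LinearMap.range f) ≤ k := by
    simpa using Submodule.finrank_le (LinearMap.range f)
  omega

/-- The lattice `Λ_v` as a submodule. -/
def lamSubmodule (n k : ℕ) (θ : ℤ) (v : Fin n → ℤ) : Submodule ℤ (Fin n → ℤ) :=
  LinearMap.ker (Matrix.mulVecLin
    (Matrix.of fun (i : Fin k) => (shiftLin ℤ n θ ^ (i : ℕ)) (revZ n v)))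

theorem mem_lamSubmodule {n k : ℕ} {θ : ℤ} {v x : Fin n → ℤ} :
    x ∈ lamSubmodule n k θ v ↔ x ∈ LamV n k θ v := by
  simp only [lamSubmodule, LinearMap.mem_ker, LamV, Set.mem_ofPred_eq, funext_iff,
    Matrix.mulVecLin_apply, Matrix.mulVec, dotProduct, Matrix.of_apply, TmapZ_iterate,
    Pi.zero_apply, Fin.forall_iff, mul_comm]

theorem finrank_lamSubmodule (n k : ℕ) (hk : 1 ≤ k) (hkn : k ≤ n) (θ : ℤ)
    (hirr : Irreducible ((Polynomial.X : Polynomial ℚ) ^ n - Polynomial.C (θ : ℚ)))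
    (v : Fin n → ℤ) (hv : v ≠ 0) : Module.finrank ℤ (lamSubmodule n k θ v) = n - k := by
  refine finrank_ker_of_linearIndependent_rows _ ?_
  set w : Fin n → ℚ := Int.castRingHom ℚ ∘ revZ n v with hw
  have hw0 : w ≠ 0 := by
    intro h
    apply hv
    ext j
    have := congrFun h j.rev
    simpa [hw, revZ] using this
  have h1 := linearIndependent_orbit (shiftLin ℚ n θ) n k hk hkn
    (aeval_shiftLin_ne_zero n θ hirr) w hw0
  rw [← linearIndependent_algebraMap_comp_iff (R := ℤ) (S := ℚ)]
  have : (fun i : Fin k => algebraMap ℤ ℚ ∘ (shiftLin ℤ n θ ^ (i : ℕ)) (revZ n v))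
      = fun i : Fin k => (shiftLin ℚ n θ ^ (i : ℕ)) w := by
    ext i j
    exact shiftLin_pow_map (Int.castRingHom ℚ) n θ (revZ n v) i j
  rw [this]
  exact h1

/-- A finite family which, up to the factor `C`, has increasing norms and is orthogonal. -/
structure IsNearlyOrthogonal {E : Type*} [NormedAddCommGroup E] [InnerProductSpace ℝ E] {m : ℕ}
    (C : ℝ) (b : Fin m → E) : Prop where
  ne_zero : ∀ i, b i ≠ 0
  norm_le : ∀ i j, i ≤ j → ‖b i‖ ≤ C * ‖b j‖
  sum_le : ∀ lam : Fin m → ℝ, ∑ i, |lam i| * ‖b i‖ ≤ C * ‖∑ i, lam i • b i‖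

section InnerProduct

variable {E : Type*} [NormedAddCommGroup E] [InnerProductSpace ℝ E]

theorem norm_sq_smul_sub_inner_smul (u x : E) :
    ‖‖u‖ ^ 2 • x - inner ℝ u x • u‖ ^ 2 = (‖u‖ ^ 2) ^ 2 * ‖x‖ ^ 2 - ‖u‖ ^ 2 * inner ℝ u x ^ 2 := by
  rw [norm_sub_sq_real, norm_smul, norm_smul, real_inner_smul_left, real_inner_smul_right,
    real_inner_comm]
  simp only [Real.norm_eq_abs, mul_pow, sq_abs]
  rw [real_inner_comm]
  ring

theorem IsNearlyOrthogonal.cons {m : ℕ} {C : ℝ} (hC : 1 ≤ C) {u : E} (hu : u ≠ 0) {c : Fin m → E}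
    (hinner : ∀ i, 2 * |inner ℝ u (c i)| ≤ ‖u‖ ^ 2) (hle : ∀ i, ‖u‖ ≤ ‖c i‖)
    (h : IsNearlyOrthogonal C (fun i => ‖u‖ ^ 2 • c i - inner ℝ u (c i) • u)) :
    IsNearlyOrthogonal (5 * C) (Fin.cons u c : Fin (m + 1) → E) := by
  have hu0 : 0 < ‖u‖ := norm_pos_iff.mpr hu
  have hN : 0 < ‖u‖ ^ 2 := by positivity
  have hup : ∀ x : E, ‖‖u‖ ^ 2 • x - inner ℝ u x • u‖ ≤ ‖u‖ ^ 2 * ‖x‖ := by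
    intro x
    refine abs_le_of_sq_le_sq' ?_ (by positivity) |>.2
    rw [norm_sq_smul_sub_inner_smul]
    have : 0 ≤ ‖u‖ ^ 2 * inner ℝ u x ^ 2 := by positivity
    nlinarith
  have hlow : ∀ i, ‖u‖ ^ 2 * ‖c i‖ ≤ 2 * ‖‖u‖ ^ 2 • c i - inner ℝ u (c i) • u‖ := by
    intro i
    refine abs_le_of_sq_le_sq' ?_ (by positivity) |>.2
    rw [mul_pow 2, norm_sq_smul_sub_inner_smul]
    have h1 : (2 * inner ℝ u (c i)) ^ 2 ≤ (‖u‖ ^ 2) ^ 2 := by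
      rw [← sq_abs, abs_mul, abs_two]
      exact pow_le_pow_left₀ (by positivity) (hinner i) 2
    have h2 : ‖u‖ ^ 2 ≤ ‖c i‖ ^ 2 := pow_le_pow_left₀ hu0.le (hle i) 2
    have h3 := mul_le_mul_of_nonneg_left h1 hN.le
    have h4 := mul_le_mul_of_nonneg_left h2 (sq_nonneg (‖u‖ ^ 2))
    nlinarith [mul_nonneg (sq_nonneg (‖u‖ ^ 2)) (sq_nonneg ‖c i‖)]
  have hsum : ∀ lam : Fin (m + 1) → ℝ, ∑ i, |lam i.succ| * ‖c i‖
      ≤ 2 * C * ‖lam 0 • u + ∑ i, lam i.succ • c i‖ := by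
    intro lam
    have h1 := h.sum_le (fun i => lam i.succ)
    set x := lam 0 • u + ∑ i, lam i.succ • c i with hx
    have h2 : ∑ i, lam i.succ • (‖u‖ ^ 2 • c i - inner ℝ u (c i) • u)
        = ‖u‖ ^ 2 • x - inner ℝ u x • u := by
      have e1 : inner ℝ u x = lam 0 * ‖u‖ ^ 2 + ∑ i, lam i.succ * inner ℝ u (c i) := by
        rw [hx, inner_add_right, inner_sum, real_inner_smul_right, real_inner_self_eq_norm_sq]
        simp only [real_inner_smul_right]
      rw [e1, hx]
      simp only [smul_sub, Finset.sum_sub_distrib, smul_add, add_smul, Finset.smul_sum,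
        Finset.sum_smul, smul_smul, mul_comm]
      abel
    rw [h2] at h1
    have h3 : ‖u‖ ^ 2 * ∑ i, |lam i.succ| * ‖c i‖ ≤ ‖u‖ ^ 2 * (2 * C * ‖x‖) := by
      calc ‖u‖ ^ 2 * ∑ i, |lam i.succ| * ‖c i‖
          = ∑ i, |lam i.succ| * (‖u‖ ^ 2 * ‖c i‖) := by
            rw [Finset.mul_sum]; exact Finset.sum_congr rfl fun i _ => by ring
        _ ≤ ∑ i, |lam i.succ| * (2 * ‖‖u‖ ^ 2 • c i - inner ℝ u (c i) • u‖) :=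
            Finset.sum_le_sum fun i _ => mul_le_mul_of_nonneg_left (hlow i) (abs_nonneg _)
        _ = 2 * ∑ i, |lam i.succ| * ‖‖u‖ ^ 2 • c i - inner ℝ u (c i) • u‖ := by
            rw [Finset.mul_sum]; exact Finset.sum_congr rfl fun i _ => by ring
        _ ≤ 2 * (C * (‖u‖ ^ 2 * ‖x‖)) := by
            have := hup x
            gcongr
            exact h1.trans (by gcongr)
        _ = ‖u‖ ^ 2 * (2 * C * ‖x‖) := by ring
    exact le_of_mul_le_mul_left h3 hN
  refine ⟨?_, ?_, ?_⟩
  · refine Fin.cases (by simpa using hu) fun i => ?_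
    simpa using norm_pos_iff.mp (hu0.trans_le (hle i))
  · refine Fin.cases (Fin.cases ?_ ?_) (fun i => Fin.cases ?_ ?_)
    · intro _
      simp only [Fin.cons_zero]
      nlinarith
    · intro j _
      simp only [Fin.cons_zero, Fin.cons_succ]
      nlinarith [hle j]
    · intro hi
      exact absurd hi (by simp)
    · intro j hij
      simp only [Fin.cons_succ]
      have h1 := h.norm_le i j (by simpa using hij)
      have h2 := hup (c j)
      have h3 := hlow i
      have h4 : ‖u‖ ^ 2 * ‖c i‖ ≤ ‖u‖ ^ 2 * (2 * C * ‖c j‖) := by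
        have := mul_le_mul_of_nonneg_left h2 (by linarith : 0 ≤ C)
        nlinarith
      have h5 := le_of_mul_le_mul_left h4 hN
      nlinarith [norm_nonneg (c j), mul_nonneg (by linarith : 0 ≤ C) (norm_nonneg (c j))]
  · intro lam
    rw [Fin.sum_univ_succ, Fin.sum_univ_succ]
    simp only [Fin.cons_zero, Fin.cons_succ]
    have h1 := hsum lam
    set x := lam 0 • u + ∑ i, lam i.succ • c i with hx
    have h2 : |lam 0| * ‖u‖ ≤ ‖x‖ + ∑ i, |lam i.succ| * ‖c i‖ := by
      have e : lam 0 • u = x - ∑ i, lam i.succ • c i := by rw [hx]; abel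
      have e2 : |lam 0| * ‖u‖ = ‖lam 0 • u‖ := by rw [norm_smul, Real.norm_eq_abs]
      rw [e2, e]
      refine (norm_sub_le _ _).trans ?_
      gcongr
      refine (norm_sum_le _ _).trans (Finset.sum_le_sum fun i _ => ?_)
      rw [norm_smul, Real.norm_eq_abs]
    nlinarith [norm_nonneg x]

theorem IsNearlyOrthogonal.linearIndependent {m : ℕ} {C : ℝ} {b : Fin m → E}
    (h : IsNearlyOrthogonal C b) : LinearIndependent ℝ b := by
  rw [Fintype.linearIndependent_iff]
  intro g hg i
  have h1 := h.sum_le g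
  rw [hg, norm_zero, mul_zero] at h1
  have h2 := Finset.single_le_sum (f := fun i => |g i| * ‖b i‖) (fun i _ => by positivity)
    (Finset.mem_univ i)
  have h3 : |g i| * ‖b i‖ = 0 := le_antisymm (h2.trans h1) (by positivity)
  simpa [h.ne_zero i] using h3

theorem IsNearlyOrthogonal.abs_mul_norm_le {m : ℕ} {C : ℝ} {b : Fin m → E}
    (h : IsNearlyOrthogonal C b) (lam : Fin m → ℝ) (i : Fin m) :
    |lam i| * ‖b i‖ ≤ C * ‖∑ i, lam i • b i‖ :=
  (Finset.single_le_sum (f := fun i => |lam i| * ‖b i‖) (fun i _ => by positivity)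
    (Finset.mem_univ i)).trans (h.sum_le lam)

theorem IsNearlyOrthogonal.update {m : ℕ} {C B : ℝ} (hC : 1 ≤ C) (hB : 0 ≤ B) {b : Fin m → E}
    (h : IsNearlyOrthogonal C b) (κ : Fin m) (c : Fin m → ℝ) (hc : ∀ i, |c i| ≤ B)
    (hc0 : ∀ i, ¬ i < κ → c i = 0) :
    IsNearlyOrthogonal ((1 + 2 * (m * B * C)) * C ^ 2)
      (Function.update b κ (b κ + ∑ i, c i • b i)) := by
  set S := ∑ i, |c i| * ‖b i‖ with hS
  have hS0 : 0 ≤ S := Finset.sum_nonneg fun i _ => by positivity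
  have hSle : S ≤ m * B * C * ‖b κ‖ := by
    have : ∀ i ∈ Finset.univ, |c i| * ‖b i‖ ≤ B * (C * ‖b κ‖) := by
      intro i _
      by_cases hi : i < κ
      · exact mul_le_mul (hc i) (h.norm_le i κ hi.le) (norm_nonneg _) hB
      · rw [hc0 i hi, abs_zero, zero_mul]; positivity
    refine (Finset.sum_le_sum this).trans (le_of_eq ?_)
    rw [Finset.sum_const, Finset.card_univ, Fintype.card_fin, nsmul_eq_mul]
    ring
  set b' := Function.update b κ (b κ + ∑ i, c i • b i) with hb'
  set D := m * B * C with hD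
  have hD0 : 0 ≤ D := by positivity
  have hκ : ‖b' κ‖ ≤ ‖b κ‖ + S := by
    rw [hb', Function.update_self]
    refine (norm_add_le _ _).trans ?_
    gcongr
    refine (norm_sum_le _ _).trans (Finset.sum_le_sum fun i _ => ?_)
    rw [norm_smul, Real.norm_eq_abs]
  have hup : ∀ i, ‖b' i‖ ≤ (1 + D) * ‖b i‖ := by
    intro i
    rcases eq_or_ne i κ with rfl | hi
    · linarith
    · rw [hb', Function.update_of_ne hi]
      nlinarith [norm_nonneg (b i)]
  have hlow : ∀ i, ‖b i‖ ≤ C * ‖b' i‖ := by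
    intro i
    rcases eq_or_ne i κ with rfl | hi
    · have := h.abs_mul_norm_le (c + Pi.single i 1) i
      simp only [Pi.add_apply, hc0 i (lt_irrefl i), Pi.single_eq_same, zero_add, abs_one, one_mul,
        add_smul, Finset.sum_add_distrib, Pi.single_apply, ite_smul, one_smul, zero_smul,
        Finset.sum_ite_eq', Finset.mem_univ, if_true] at this
      rwa [hb', Function.update_self, add_comm]
    · rw [hb', Function.update_of_ne hi]
      nlinarith [norm_nonneg (b i)]
  refine ⟨?_, ?_, ?_⟩
  · intro i hi
    have := hlow i
    rw [hi, norm_zero, mul_zero] at this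
    exact h.ne_zero i (norm_le_zero_iff.mp this)
  · intro i j hij
    calc ‖b' i‖ ≤ (1 + D) * ‖b i‖ := hup i
      _ ≤ (1 + D) * (C * (C * ‖b' j‖)) := by
          gcongr
          exact (h.norm_le i j hij).trans (by gcongr; exact hlow j)
      _ = (1 + D) * (C ^ 2 * ‖b' j‖) := by ring
      _ ≤ (1 + 2 * D) * (C ^ 2 * ‖b' j‖) := by gcongr; linarith
      _ = _ := by ring
  · intro μ
    set ν : Fin m → ℝ := fun i => μ i + μ κ * c i with hν
    have hνκ : ν κ = μ κ := by simp [hν, hc0 κ (lt_irrefl κ)]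
    have hx : ∑ i, μ i • b' i = ∑ i, ν i • b i := by
      have : ∀ i, μ i • b' i = μ i • b i + (if i = κ then μ κ • ∑ i, c i • b i else 0) := by
        intro i
        split_ifs with hi
        · subst hi; rw [hb', Function.update_self, smul_add]
        · rw [hb', Function.update_of_ne hi, add_zero]
      simp only [this, Finset.sum_add_distrib, Finset.sum_ite_eq', Finset.mem_univ, if_true, hν,
        add_smul, Finset.smul_sum, mul_smul]
    have h1 := h.sum_le ν
    have h2 := h.abs_mul_norm_le ν κ
    rw [hx]
    set x := ∑ i, ν i • b i
    have h3 : ∑ i, |μ i| * ‖b' i‖ ≤ ∑ i, |ν i| * ‖b i‖ + 2 * (|μ κ| * S) := by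
      have : ∀ i ∈ Finset.univ, |μ i| * ‖b' i‖ ≤ |ν i| * ‖b i‖ + |μ κ| * (|c i| * ‖b i‖)
          + (if i = κ then |μ κ| * S else 0) := by
        intro i _
        split_ifs with hi
        · subst hi
          rw [hνκ, hc0 i (lt_irrefl i), abs_zero, zero_mul, mul_zero, add_zero, ← mul_add]
          gcongr
        · rw [hb', Function.update_of_ne hi, add_zero, ← mul_assoc, ← add_mul]
          gcongr
          have : μ i = ν i - μ κ * c i := by simp [hν]
          rw [this, ← abs_mul]
          exact abs_sub _ _
      refine (Finset.sum_le_sum this).trans (le_of_eq ?_)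
      rw [Finset.sum_add_distrib, Finset.sum_add_distrib, ← Finset.mul_sum]
      simp only [Finset.sum_ite_eq', Finset.mem_univ, if_true]
      ring
    rw [hνκ] at h2
    have h4 : |μ κ| * S ≤ D * (C * ‖x‖) := by
      calc |μ κ| * S ≤ |μ κ| * (D * ‖b κ‖) := by gcongr
        _ = D * (|μ κ| * ‖b κ‖) := by ring
        _ ≤ _ := by gcongr
    calc ∑ i, |μ i| * ‖b' i‖ ≤ (1 + 2 * D) * (C * ‖x‖) := by linarith
      _ ≤ (1 + 2 * D) * (C ^ 2 * ‖x‖) := by gcongr; nlinarith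
      _ = _ := by ring

end InnerProduct

/-- Integer vectors as points of Euclidean space. -/
def intEmbed (n : ℕ) : (Fin n → ℤ) →ₗ[ℤ] EuclideanSpace ℝ (Fin n) where
  toFun x := WithLp.toLp 2 fun i => (x i : ℝ)
  map_add' x y := by ext i; simp
  map_smul' c x := by ext i; simp

theorem inner_intEmbed {n : ℕ} (x y : Fin n → ℤ) :
    inner ℝ (intEmbed n x) (intEmbed n y) = ((x ⬝ᵥ y : ℤ) : ℝ) := by
  simp [intEmbed, dotProduct, PiLp.inner_apply, mul_comm]

theorem norm_sq_intEmbed {n : ℕ} (x : Fin n → ℤ) :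
    ‖intEmbed n x‖ ^ 2 = ((x ⬝ᵥ x : ℤ) : ℝ) := by
  rw [← real_inner_self_eq_norm_sq, inner_intEmbed]

theorem intEmbed_injective (n : ℕ) : Function.Injective (intEmbed n) := by
  intro x y h
  ext i
  simpa [intEmbed] using congrArg (fun z : EuclideanSpace ℝ (Fin n) => z i) h

theorem dotProduct_self_pos_of_ne_zero {n : ℕ} {x : Fin n → ℤ} (hx : x ≠ 0) : 0 < x ⬝ᵥ x :=
  lt_of_le_of_ne (Finset.sum_nonneg fun i _ => mul_self_nonneg (x i))
    fun h => hx (dotProduct_self_eq_zero.mp h.symm)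

theorem exists_two_mul_abs_sub_mul_le (s N : ℤ) (hN : 0 < N) : ∃ r : ℤ, 2 * |s - r * N| ≤ N := by
  refine ⟨(2 * s + N) / (2 * N), ?_⟩
  have h1 := Int.emod_add_mul_ediv (2 * s + N) (2 * N)
  have h2 := Int.emod_nonneg (2 * s + N) (by omega : 2 * N ≠ 0)
  have h3 := Int.emod_lt_of_pos (2 * s + N) (by omega : 0 < 2 * N)
  set q := (2 * s + N) / (2 * N)
  have h4 : 2 * |s - q * N| = |2 * (s - q * N)| := by rw [abs_mul, abs_two]
  rw [h4, abs_le]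
  constructor <;> nlinarith

/-- The projection to the orthogonal complement of `u`, scaled by `u ⬝ᵥ u`. -/
def scaledProj {n : ℕ} (u : Fin n → ℤ) : (Fin n → ℤ) →ₗ[ℤ] (Fin n → ℤ) where
  toFun x := (u ⬝ᵥ u) • x - (u ⬝ᵥ x) • u
  map_add' x y := by rw [dotProduct_add, smul_add, add_smul]; abel
  map_smul' c x := by
    rw [dotProduct_smul, RingHom.id_apply, smul_sub, smul_comm, smul_eq_mul, mul_smul]

theorem intEmbed_scaledProj {n : ℕ} (u x : Fin n → ℤ) :
    intEmbed n (scaledProj u x) = ‖intEmbed n u‖ ^ 2 • intEmbed n x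
      - inner ℝ (intEmbed n u) (intEmbed n x) • intEmbed n u := by
  rw [norm_sq_intEmbed, inner_intEmbed]
  ext i
  simp [scaledProj, intEmbed]

theorem scaledProj_self {n : ℕ} (u : Fin n → ℤ) : scaledProj u u = 0 := by
  simp [scaledProj]

theorem mem_span_of_scaledProj_eq_zero {n : ℕ} {L : Submodule ℤ (Fin n → ℤ)} {u : Fin n → ℤ}
    (hu : u ≠ 0) (huL : u ∈ L) (hmin : ∀ x ∈ L, x ≠ 0 → u ⬝ᵥ u ≤ x ⬝ᵥ x) {x : Fin n → ℤ}
    (hx : x ∈ L) (hx0 : scaledProj u x = 0) : x ∈ Submodule.span ℤ {u} := by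
  have hN := dotProduct_self_pos_of_ne_zero hu
  obtain ⟨r, hr⟩ := exists_two_mul_abs_sub_mul_le (u ⬝ᵥ x) (u ⬝ᵥ u) hN
  set y := x - r • u with hy
  have hyL : y ∈ L := L.sub_mem hx (L.smul_mem r huL)
  have hy0 : scaledProj u y = 0 := by rw [hy, map_sub, map_smul, hx0, scaledProj_self]; simp
  have huy : u ⬝ᵥ y = u ⬝ᵥ x - r * (u ⬝ᵥ u) := by
    rw [hy, dotProduct_sub, dotProduct_smul, smul_eq_mul]
  rw [← huy] at hr
  have hyy : (u ⬝ᵥ u) * (y ⬝ᵥ y) = (u ⬝ᵥ y) ^ 2 := by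
    have := congrArg (fun z => y ⬝ᵥ z) hy0
    simp only [scaledProj, LinearMap.coe_mk, AddHom.coe_mk, dotProduct_sub, dotProduct_smul,
      smul_eq_mul, dotProduct_zero] at this
    rw [dotProduct_comm y u] at this
    linarith
  have hy1 : y = 0 := by
    by_contra hne
    have h1 := hmin y hyL hne
    have h2 : (2 * |u ⬝ᵥ y|) ^ 2 ≤ (u ⬝ᵥ u) ^ 2 := pow_le_pow_left₀ (by positivity) hr 2
    rw [mul_pow, sq_abs] at h2
    nlinarith
  rw [Submodule.mem_span_singleton]
  exact ⟨r, (sub_eq_zero.mp hy1).symm⟩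

theorem finrank_map_scaledProj {n m : ℕ} {L : Submodule ℤ (Fin n → ℤ)}
    (hL : Module.finrank ℤ L = m + 1) {u : Fin n → ℤ}
    (hu : u ≠ 0) (huL : u ∈ L) (hmin : ∀ x ∈ L, x ≠ 0 → u ⬝ᵥ u ≤ x ⬝ᵥ x) :
    Module.finrank ℤ (L.map (scaledProj u)) = m := by
  set f := (scaledProj u).domRestrict L with hf
  have h1 := Submodule.finrank_quotient_add_finrank (LinearMap.ker f)
  rw [f.quotKerEquivRange.finrank_eq, hL, hf, LinearMap.range_domRestrict] at h1
  have hker : LinearMap.ker f = Submodule.span ℤ {⟨u, huL⟩} := by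
    ext ⟨x, hx⟩
    rw [LinearMap.mem_ker, hf, LinearMap.domRestrict_apply, Submodule.mem_span_singleton]
    constructor
    · intro h
      obtain ⟨r, hr⟩ := Submodule.mem_span_singleton.mp
        (mem_span_of_scaledProj_eq_zero hu huL hmin hx h)
      exact ⟨r, Subtype.ext hr⟩
    · rintro ⟨r, hr⟩
      have : r • u = x := congrArg Subtype.val hr
      change scaledProj u x = 0
      rw [← this, map_smul, scaledProj_self, smul_zero]
  have h2 : Module.finrank ℤ (LinearMap.ker f) = 1 := by
    have hne : (⟨u, huL⟩ : L) ≠ 0 := fun h => hu (congrArg Subtype.val h)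
    rw [hker, ← (LinearEquiv.toSpanNonzeroSingleton ℤ L _ hne).finrank_eq, Module.finrank_self]
  rw [← hf, h2] at h1
  omega

theorem exists_isNearlyOrthogonal_basis (n m : ℕ) : ∀ L : Submodule ℤ (Fin n → ℤ),
    Module.finrank ℤ L = m → ∃ b : Fin m → (Fin n → ℤ), Submodule.span ℤ (Set.range b) = L ∧
      IsNearlyOrthogonal (5 ^ m) (fun i => intEmbed n (b i)) := by
  induction m with
  | zero =>
    intro L hL
    refine ⟨Fin.elim0, ?_, ⟨fun i => i.elim0, fun i => i.elim0, fun lam => by simp⟩⟩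
    rw [Submodule.finrank_eq_zero.mp hL]
    simp
  | succ m ih =>
    intro L hL
    have hLne : L ≠ ⊥ := by
      rintro rfl
      simp at hL
    obtain ⟨x₀, hx₀, hx₀ne⟩ := (Submodule.ne_bot_iff _).mp hLne
    obtain ⟨u, ⟨huL, hu⟩, hmin'⟩ := (measure fun x : Fin n → ℤ => (x ⬝ᵥ x).toNat).wf.has_min
      {x | x ∈ L ∧ x ≠ 0} ⟨x₀, hx₀, hx₀ne⟩
    have hmin : ∀ x ∈ L, x ≠ 0 → u ⬝ᵥ u ≤ x ⬝ᵥ x := by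
      intro x hx hx0
      have h1 : ¬ (x ⬝ᵥ x).toNat < (u ⬝ᵥ u).toNat := hmin' x ⟨hx, hx0⟩
      have h2 := dotProduct_self_pos_of_ne_zero hx0
      have h3 := dotProduct_self_pos_of_ne_zero hu
      omega
    have hN := dotProduct_self_pos_of_ne_zero hu
    obtain ⟨b, hb, hbo⟩ := ih _ (finrank_map_scaledProj hL hu huL hmin)
    have hlift : ∀ i, ∃ c ∈ L, scaledProj u c = b i ∧ 2 * |u ⬝ᵥ c| ≤ u ⬝ᵥ u := by
      intro i
      have : b i ∈ L.map (scaledProj u) := by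
        rw [← hb]; exact Submodule.subset_span ⟨i, rfl⟩
      obtain ⟨x, hx, hxb⟩ := this
      obtain ⟨r, hr⟩ := exists_two_mul_abs_sub_mul_le (u ⬝ᵥ x) (u ⬝ᵥ u) hN
      refine ⟨x - r • u, L.sub_mem hx (L.smul_mem r huL), ?_, ?_⟩
      · rw [map_sub, map_smul, scaledProj_self, hxb, smul_zero, sub_zero]
      · rwa [dotProduct_sub, dotProduct_smul, smul_eq_mul]
    choose c hcL hcb hcu using hlift
    have hbne : ∀ i, b i ≠ 0 := fun i hi => hbo.ne_zero i (by simp [hi])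
    have hcne : ∀ i, c i ≠ 0 := fun i hi => hbne i (by rw [← hcb, hi, map_zero])
    refine ⟨Fin.cons u c, ?_, ?_⟩
    · apply le_antisymm
      · rw [Submodule.span_le]
        rintro _ ⟨i, rfl⟩
        refine Fin.cases ?_ (fun i => ?_) i
        · simpa using huL
        · simpa using hcL i
      · intro x hx
        have h1 : scaledProj u x ∈ (Submodule.span ℤ (Set.range c)).map (scaledProj u) := by
          rw [Submodule.map_span, ← Set.range_comp]
          have : scaledProj u ∘ c = b := funext hcb
          rw [this, hb]
          exact ⟨x, hx, rfl⟩
        obtain ⟨y, hy, hyx⟩ := h1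
        have hyL : y ∈ L := by
          refine (Submodule.span_le.mpr ?_ : Submodule.span ℤ (Set.range c) ≤ L) hy
          rintro _ ⟨i, rfl⟩
          exact hcL i
        have h2 : x - y ∈ Submodule.span ℤ {u} :=
          mem_span_of_scaledProj_eq_zero hu huL hmin (L.sub_mem hx hyL)
            (by rw [map_sub, hyx, sub_self])
        rw [Fin.range_cons, ← sub_add_cancel x y]
        refine Submodule.add_mem _ (Submodule.span_mono ?_ h2) (Submodule.span_mono ?_ hy)
        · simp
        · exact Set.subset_insert _ _
    · have h5 : (1 : ℝ) ≤ 5 ^ m := one_le_pow₀ (by norm_num)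
      have hcons := IsNearlyOrthogonal.cons h5 (u := intEmbed n u)
        (c := fun i => intEmbed n (c i))
        (fun h => hu (intEmbed_injective n (by rw [h, map_zero])))
        (fun i => by
          rw [norm_sq_intEmbed, inner_intEmbed]
          exact_mod_cast hcu i)
        (fun i => by
          refine abs_le_of_sq_le_sq' ?_ (norm_nonneg _) |>.2
          rw [norm_sq_intEmbed, norm_sq_intEmbed]
          exact_mod_cast hmin _ (hcL i) (hcne i))
        (by simpa only [← intEmbed_scaledProj, hcb] using hbo)
      rw [pow_succ']
      convert hcons using 1
      ext i : 1
      refine Fin.cases ?_ (fun i => ?_) i <;> simp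

theorem nrmZ_eq_norm {n : ℕ} (x : Fin n → ℤ) : nrmZ x = ‖intEmbed n x‖ := by
  simp [nrmZ, intEmbed, EuclideanSpace.norm_eq]

theorem IsNearlyOrthogonal.linearIndependent_int {n m : ℕ} {C : ℝ} {b : Fin m → (Fin n → ℤ)}
    (hb : IsNearlyOrthogonal C (fun i => intEmbed n (b i))) : LinearIndependent ℤ b := by
  have h1 : LinearIndependent ℤ (intEmbed n ∘ b) :=
    hb.linearIndependent.restrict_scalars (by simpa using Int.cast_injective)
  exact LinearIndependent.of_comp _ h1

theorem isNearlyOrthogonal_successive_minima {n m : ℕ} {C : ℝ} (hC : 1 ≤ C)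
    {b : Fin m → (Fin n → ℤ)} (hb : IsNearlyOrthogonal C (fun i => intEmbed n (b i)))
    {S : Set (Fin n → ℤ)} (hS : ∀ x, x ∈ S ↔ x ∈ Submodule.span ℤ (Set.range b)) (j : Fin m)
    {Z : ℝ} (hZ : IsLeast {r : ℝ | ∃ w : Fin (j + 1) → (Fin n → ℤ),
      (∀ i, w i ∈ S) ∧ LinearIndependent ℤ w ∧ ∀ i, nrmZ (w i) ≤ r} Z) :
    nrmZ (b j) ≤ C ^ 2 * Z ∧ Z ≤ C * nrmZ (b j) := by
  have hli := hb.linearIndependent_int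
  constructor
  · obtain ⟨w, hwS, hwli, hwZ⟩ := hZ.1
    obtain ⟨i, g, hg, l, hjl, hgl⟩ : ∃ i, ∃ g : Fin m → ℤ,
        ∑ l, g l • b l = w i ∧ ∃ l, j ≤ l ∧ g l ≠ 0 := by
      by_contra! hcon
      have hsub : ∀ i, w i ∈ Submodule.span ℤ (Set.range fun l : Fin j => b ⟨l, l.2.trans j.2⟩) := by
        intro i
        obtain ⟨g, hg⟩ := (Submodule.mem_span_range_iff_exists_fun ℤ).mp ((hS _).mp (hwS i))
        rw [← hg]
        refine Submodule.sum_mem _ fun l _ => ?_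
        by_cases hl : j ≤ l
        · rw [hcon i g hg l hl, zero_smul]
          exact Submodule.zero_mem _
        · exact Submodule.smul_mem _ _ (Submodule.subset_span ⟨⟨l, not_le.mp hl⟩, rfl⟩)
      have h1 : Submodule.span ℤ (Set.range w)
          ≤ Submodule.span ℤ (Set.range fun l : Fin j => b ⟨l, l.2.trans j.2⟩) := by
        rw [Submodule.span_le]
        rintro _ ⟨i, rfl⟩
        exact hsub i
      have h2 := Submodule.finrank_mono h1
      have h3 : Module.finrank ℤ (Submodule.span ℤ
          (Set.range fun l : Fin j => b ⟨l, l.2.trans j.2⟩)) ≤ j :=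
        (finrank_range_le_card (R := ℤ) fun l : Fin j => b ⟨l, l.2.trans j.2⟩).trans_eq
          (Fintype.card_fin _)
      rw [finrank_span_eq_card hwli, Fintype.card_fin] at h2
      omega
    have h1 := hb.abs_mul_norm_le (fun l => (g l : ℝ)) l
    have h2 : ∑ l, (g l : ℝ) • intEmbed n (b l) = intEmbed n (w i) := by
      rw [← hg, map_sum]
      exact Finset.sum_congr rfl fun l _ => by rw [map_smul, Int.cast_smul_eq_zsmul]
    rw [h2, ← nrmZ_eq_norm, ← nrmZ_eq_norm] at h1
    have h3 : (1 : ℝ) ≤ |(g l : ℝ)| := by exact_mod_cast Int.one_le_abs hgl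
    have h4 := hb.norm_le j l hjl
    rw [← nrmZ_eq_norm, ← nrmZ_eq_norm] at h4
    have h5 : 0 ≤ nrmZ (b l) := Real.sqrt_nonneg _
    calc nrmZ (b j) ≤ C * nrmZ (b l) := h4
      _ ≤ C * (|(g l : ℝ)| * nrmZ (b l)) := by gcongr; exact le_mul_of_one_le_left h5 h3
      _ ≤ C * (C * Z) := by
          have := mul_le_mul_of_nonneg_left (hwZ i) (by linarith : 0 ≤ C)
          exact mul_le_mul_of_nonneg_left (h1.trans this) (by linarith)
      _ = C ^ 2 * Z := by ring
  · refine hZ.2 ⟨fun i => b ⟨i, by omega⟩, fun i => ?_, ?_, fun i => ?_⟩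
    · exact (hS _).mpr (Submodule.subset_span ⟨_, rfl⟩)
    · exact hli.comp (fun i : Fin (j + 1) => (⟨i, by omega⟩ : Fin m))
        (fun a b h => by simpa [Fin.ext_iff] using h)
    · rw [nrmZ_eq_norm, nrmZ_eq_norm]
      exact hb.norm_le _ _ (by rw [Fin.le_def]; simp only; omega)

theorem span_range_update_add_sum {n m : ℕ} (b : Fin m → (Fin n → ℤ)) (κ : Fin m)
    (c : Fin m → ℤ) (hc : c κ = 0) :
    Submodule.span ℤ (Set.range (Function.update b κ (b κ + ∑ i, c i • b i)))
      = Submodule.span ℤ (Set.range b) := by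
  apply le_antisymm <;> rw [Submodule.span_le] <;> rintro _ ⟨i, rfl⟩
  · have hmem : ∀ i, b i ∈ Submodule.span ℤ (Set.range b) :=
      fun i => Submodule.subset_span ⟨i, rfl⟩
    rcases eq_or_ne i κ with rfl | hi
    · rw [Function.update_self]
      exact Submodule.add_mem _ (hmem i)
        (Submodule.sum_mem _ fun j _ => Submodule.smul_mem _ _ (hmem j))
    · rw [Function.update_of_ne hi]
      exact hmem i
  · set b' := Function.update b κ (b κ + ∑ i, c i • b i) with hb'
    have hmem : ∀ i, b' i ∈ Submodule.span ℤ (Set.range b') :=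
      fun i => Submodule.subset_span ⟨i, rfl⟩
    have hne : ∀ i, i ≠ κ → b i ∈ Submodule.span ℤ (Set.range b') := fun i hi => by
      have := hmem i
      rwa [hb', Function.update_of_ne hi, ← hb'] at this
    rcases eq_or_ne i κ with rfl | hi
    · have h1 : b i = b' i - ∑ j, c j • b j := by
        rw [hb', Function.update_self, add_sub_cancel_right]
      rw [h1]
      refine Submodule.sub_mem _ (hmem i) (Submodule.sum_mem _ fun j _ => ?_)
      rcases eq_or_ne j i with rfl | hj
      · rw [hc, zero_smul]; exact Submodule.zero_mem _
      · exact Submodule.smul_mem _ _ (hne j hj)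
    · exact hne i hi

theorem nrmR_sum_smul {n m : ℕ} (z : Fin m → (Fin n → ℤ)) (lam : Fin m → ℝ) :
    nrmR (∑ i, lam i • (fun t => ((z i t : ℝ)))) = ‖∑ i, lam i • intEmbed n (z i)‖ := by
  rw [nrmR, EuclideanSpace.norm_eq]
  congr 1
  refine Finset.sum_congr rfl fun t _ => ?_
  simp [intEmbed]

theorem linearIndependent_Tmap_iterate {n k : ℕ} (θ : ℤ) (x y : Fin n → ℤ)
    (h : LinearIndependent ℚ
      (orbitPair (shiftLin ℚ n θ) k (algebraMap ℤ ℚ ∘ x) (algebraMap ℤ ℚ ∘ y))) :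
    LinearIndependent ℝ (fun i : Fin (2 * k) =>
      if (i : ℕ) < k then (Tmap n θ)^[(i : ℕ)] (fun t => (x t : ℝ))
      else (Tmap n θ)^[(i : ℕ) - k] (fun t => (y t : ℝ))) := by
  rw [← linearIndependent_algebraMap_comp_iff (R := ℚ) (S := ℝ)] at h
  let e : Fin k ⊕ Fin k ≃ Fin (2 * k) := finSumFinEquiv.trans (finCongr (two_mul k).symm)
  rw [← linearIndependent_equiv e]
  have key : ∀ (w : Fin n → ℤ) (i : ℕ), (Tmap n θ)^[i] (fun t => (w t : ℝ))
      = algebraMap ℚ ℝ ∘ (shiftLin ℚ n θ ^ i) (algebraMap ℤ ℚ ∘ w) := by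
    intro w i
    ext j
    rw [Tmap_iterate, Function.comp_apply, shiftLin_pow_map (algebraMap ℚ ℝ)]
    congr 3
  have horbit : (fun i : Fin (2 * k) =>
      if (i : ℕ) < k then (Tmap n θ)^[(i : ℕ)] (fun t => (x t : ℝ))
      else (Tmap n θ)^[(i : ℕ) - k] (fun t => (y t : ℝ))) ∘ e
      = fun i => algebraMap ℚ ℝ ∘
        orbitPair (shiftLin ℚ n θ) k (algebraMap ℤ ℚ ∘ x) (algebraMap ℤ ℚ ∘ y) i := by
    ext (i | i) : 1 <;> simp [e, orbitPair, key]
  rw [horbit]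
  exact h

/-- **Nice bases of the lattices `Λ_v`.**  Let `n > 3k`, `K = ℚ(θ^{1/n})` with `x^n - θ`
irreducible.  For every `v ∈ ℤ^n \ {0}` the lattice `Λ_v` has rank `n-k` and admits a
ℤ-basis `z_1, …, z_{n-k}` with `‖z_i‖ ≍ Z_i` (the successive minima),
`‖∑ λᵢ zᵢ‖ ≫ ∑ ‖λᵢ zᵢ‖` for all real `λᵢ`, and such that the `2k` vectors
`T^0(z_1), …, T^{k-1}(z_1), T^0(z_{k+1}), …, T^{k-1}(z_{k+1})` are linearly independent. -/
theorem stmt_15 (n k : ℕ) (hk : 1 ≤ k) (hnk : 3 * k < n) (θ : ℤ) (hθ : θ ≠ 0)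
    (hirr : Irreducible ((Polynomial.X : Polynomial ℚ) ^ n - Polynomial.C (θ : ℚ))) :
    ∃ C : ℝ, 0 < C ∧
      ∀ v : Fin n → ℤ, v ≠ 0 →
      ∀ Z : ℕ → ℝ,
        (∀ j < n - k, IsLeast {r : ℝ | ∃ w : Fin (j + 1) → (Fin n → ℤ),
            (∀ i, w i ∈ LamV n k θ v) ∧ LinearIndependent ℤ w ∧ ∀ i, nrmZ (w i) ≤ r} (Z j)) →
      ∃ z : Fin (n - k) → (Fin n → ℤ),
        LinearIndependent ℤ z ∧
        (∀ x : Fin n → ℤ, x ∈ LamV n k θ v ↔ x ∈ Submodule.span ℤ (Set.range z)) ∧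
        (∀ i : Fin (n - k), nrmZ (z i) ≤ C * Z (i : ℕ) ∧ Z (i : ℕ) ≤ C * nrmZ (z i)) ∧
        (∀ lam : Fin (n - k) → ℝ,
          ∑ i, |lam i| * nrmZ (z i) ≤ C * nrmR (∑ i, lam i • (fun t => ((z i t : ℝ))))) ∧
        LinearIndependent ℝ (fun i : Fin (2 * k) =>
          if (i : ℕ) < k then (Tmap n θ)^[(i : ℕ)] (fun t => ((z ⟨0, by omega⟩ t : ℝ)))
          else (Tmap n θ)^[(i : ℕ) - k] (fun t => ((z ⟨k, by omega⟩ t : ℝ)))) := by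
  set m := n - k with hm
  have hkm : k < m := by omega
  set C₀ : ℝ := 5 ^ m with hC₀
  have hC₀1 : 1 ≤ C₀ := one_le_pow₀ (by norm_num)
  set C₁ : ℝ := (1 + 2 * (m * (2 * k : ℝ) * C₀)) * C₀ ^ 2 with hC₁
  have hC₁1 : 1 ≤ C₁ := by
    have h1 : (0 : ℝ) ≤ 2 * (m * (2 * k : ℝ) * C₀) := by positivity
    exact one_le_mul_of_one_le_of_one_le (by linarith) (one_le_pow₀ hC₀1)
  have hC₁2 : C₁ ≤ C₁ ^ 2 := le_self_pow₀ hC₁1 (by norm_num)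
  refine ⟨C₁ ^ 2, by positivity, fun v hv Z hZ => ?_⟩
  obtain ⟨b, hbspan, hb⟩ := exists_isNearlyOrthogonal_basis n m (lamSubmodule n k θ v)
    (finrank_lamSubmodule n k hk (by omega) θ hirr v hv)
  let ι : Fin (k + 1) → Fin m := Fin.castLE hkm
  let y : Fin (k + 1) → (Fin n → ℚ) := fun i => algebraMap ℤ ℚ ∘ b (ι i)
  have hy : LinearIndependent ℚ y := (linearIndependent_algebraMap_comp_iff (R := ℤ) (S := ℚ)).mpr
    (hb.linearIndependent_int.comp ι (Fin.castLE_injective hkm))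
  obtain ⟨c, hc, hLI⟩ := exists_bounded_combination (shiftLin ℚ n θ) n k hk hnk
    (aeval_shiftLin_ne_zero n θ hirr) (y 0) (hy.ne_zero 0) y hy
  let κ : Fin m := ⟨k, hkm⟩
  let c' : Fin m → ℤ := fun i => if h : (i : ℕ) < k then c ⟨i, h⟩ else 0
  have hc'0 : ∀ i, ¬ i < κ → c' i = 0 := fun i hi => dif_neg (by simpa [κ, Fin.lt_def] using hi)
  have hc'le : ∀ i, |(c' i : ℝ)| ≤ 2 * k := by
    intro i
    by_cases h : (i : ℕ) < k
    · simp only [c', dif_pos h, Int.cast_natCast, Nat.abs_cast]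
      exact_mod_cast hc _
    · simp only [c', dif_neg h, Int.cast_zero, abs_zero]
      positivity
  have hsum : ∑ i, c' i • b i = ∑ i : Fin k, (c i : ℤ) • b (ι i.castSucc) := by
    symm
    refine Fintype.sum_of_injective (fun i : Fin k => ι i.castSucc)
      (fun i j h => by simpa [ι, Fin.ext_iff] using h) _ _ (fun i hi => ?_) (fun i => ?_)
    · rw [hc'0 i fun hlt => hi ⟨⟨i, hlt⟩, rfl⟩, zero_smul]
    · simp [c', ι]
  set z : Fin m → (Fin n → ℤ) := Function.update b κ (b κ + ∑ i, c' i • b i) with hz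
  have hzo : IsNearlyOrthogonal C₁ (fun i => intEmbed n (z i)) := by
    have := IsNearlyOrthogonal.update hC₀1 (by positivity : (0 : ℝ) ≤ 2 * k) hb κ
      (fun i => (c' i : ℝ)) hc'le (fun i hi => by simp [hc'0 i hi])
    convert this using 1
    ext i : 1
    rcases eq_or_ne i κ with rfl | hi
    · simp only [hz, Function.update_self, map_add, map_sum, map_smul, Int.cast_smul_eq_zsmul]
    · simp [hz, hi]
  have hzspan : ∀ x, x ∈ LamV n k θ v ↔ x ∈ Submodule.span ℤ (Set.range z) := by
    intro x
    rw [hz, span_range_update_add_sum b κ c' (hc'0 κ (lt_irrefl κ)), hbspan, mem_lamSubmodule]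
  refine ⟨z, hzo.linearIndependent_int, hzspan, fun i => ?_, fun lam => ?_, ?_⟩
  · obtain ⟨h1, h2⟩ := isNearlyOrthogonal_successive_minima hC₁1 hzo hzspan i (hZ i i.2)
    exact ⟨h1, h2.trans (mul_le_mul_of_nonneg_right hC₁2 (Real.sqrt_nonneg _))⟩
  · rw [nrmR_sum_smul]
    simp only [nrmZ_eq_norm]
    exact (hzo.sum_le lam).trans (mul_le_mul_of_nonneg_right hC₁2 (norm_nonneg _))
  · apply linearIndependent_Tmap_iterate
    have hz0 : algebraMap ℤ ℚ ∘ z ⟨0, by omega⟩ = y 0 := by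
      have : (⟨0, by omega⟩ : Fin m) ≠ κ := by simp [κ, Fin.ext_iff]; omega
      rw [hz, Function.update_of_ne this]
      rfl
    have hzκ : algebraMap ℤ ℚ ∘ z κ
        = y (Fin.last k) + ∑ i : Fin k, (c i : ℚ) • y i.castSucc := by
      rw [hz, Function.update_self, hsum]
      ext t
      simp [y, ι, κ, Finset.sum_apply]
      rfl
    rw [hz0, hzκ]
    exact hLI
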